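/- Let m ≥ 2 be even. For s, t ∈ 𝔽_q let N(s,t) = #{(α,β) ∈ 𝔽_{q^m} × 𝔽_{q^m} : Tr(α²) = s and Tr(β²) = t}. Then, as identities of complex numbers: N(0,0) = (q^{m−1} + q^{−1}(q−1)G)²; for s ≠ 0, N(s,0) = q^{2m−2} + q^{m−2}(q−2)G − q^{−2}(q−1)G²; for t ≠ 0, N(0,t) = q^{2m−2} + q^{m−2}(q−2)G − q^{−2}(q−1)G²; and for s ≠ 0 and t ≠ 0, N(s,t) = (q^{m−1} − q^{−1}G)². -/

import Mathlib

open Finset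

/-- The additive character `s ↦ exp(2πi·s̃/q)` of `ZMod q`. -/
noncomputable def zetaQ (q : ℕ) (s : ZMod q) : ℂ :=
  Complex.exp (2 * Real.pi * Complex.I * (s.val : ℂ) / (q : ℂ))

/-- The quadratic Gauss sum `G` over the big field `F`. -/
noncomputable def gaussBig (q : ℕ) [Fact q.Prime] (F : Type*) [Field F] [Fintype F]
    [DecidableEq F] [Algebra (ZMod q) F] : ℂ :=
  ∑ x ∈ Finset.univ.filter (fun x : F => x ≠ 0),
    (quadraticChar F x : ℂ) * zetaQ q (Algebra.trace (ZMod q) F x)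

/-- The quadratic Gauss sum `Ḡ` over the prime field `ZMod q`. -/
noncomputable def gaussSmall (q : ℕ) [Fact q.Prime] : ℂ :=
  ∑ y ∈ Finset.univ.filter (fun y : ZMod q => y ≠ 0),
    (quadraticChar (ZMod q) y : ℂ) * zetaQ q y

/-- `N(s,t) = #{(α,β) : Tr(α²) = s, Tr(β²) = t}`. -/
noncomputable def Ncount (q : ℕ) (F : Type*) [Field F] [Fintype F] [Algebra (ZMod q) F]
    (s t : ZMod q) : ℕ :=
  Nat.card {p : F × F // Algebra.trace (ZMod q) F (p.1 ^ 2) = s ∧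
    Algebra.trace (ZMod q) F (p.2 ^ 2) = t}

/-- The quadratic character of a finite field, with values in a commutative ring `R`. -/
noncomputable def quadraticCharTo (F R : Type*) [Field F] [Fintype F] [DecidableEq F]
    [CommRing R] : MulChar F R :=
  (quadraticChar F).ringHomComp (Int.castRingHom R)

theorem quadraticCharTo_apply {F R : Type*} [Field F] [Fintype F] [DecidableEq F]
    [CommRing R] (x : F) : quadraticCharTo F R x = (quadraticChar F x : R) := rfl

/-- The sum of a nontrivial additive character over the squares, counted with multiplicity, is
the quadratic Gauss sum. -/
theorem sum_addChar_sq {F R : Type*} [Field F] [Fintype F] [DecidableEq F] [CommRing R]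
    [IsDomain R] (hF : ringChar F ≠ 2) {ψ : AddChar F R} (hψ : ψ ≠ 1) :
    ∑ a : F, ψ (a ^ 2) = gaussSum (quadraticCharTo F R) ψ := by
  have hfib : ∀ x : F, (#{a : F | a ^ 2 = x} : R) = quadraticCharTo F R x + 1 := by
    intro x
    have h := congrArg (Int.cast : ℤ → R) (quadraticChar_card_sqrts hF x)
    simpa [quadraticCharTo_apply, Set.toFinset_ofPred] using h
  calc ∑ a : F, ψ (a ^ 2) = ∑ x : F, ∑ a : F with a ^ 2 = x, ψ (a ^ 2) :=
        (sum_fiberwise _ _ _).symm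
    _ = ∑ x : F, (quadraticCharTo F R x + 1) * ψ x := by
        refine sum_congr rfl fun x _ => ?_
        rw [← hfib, ← nsmul_eq_mul, ← sum_const]
        exact sum_congr rfl fun a ha => by rw [(mem_filter.mp ha).2]
    _ = gaussSum (quadraticCharTo F R) ψ := by
        simp [add_mul, sum_add_distrib, gaussSum, AddChar.sum_eq_zero_of_ne_one hψ]

theorem card_sub_one_dvd_half_card_pow {q m : ℕ} (hq : Odd q) (hm : Even m) :
    q - 1 ∣ q ^ m / 2 := by
  obtain ⟨k, rfl⟩ := hm
  obtain ⟨r, rfl⟩ := hq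
  obtain ⟨c, hc⟩ := Nat.sub_dvd_pow_sub_pow ((2 * r + 1) ^ 2) 1 k
  have hpos : 1 ≤ (2 * r + 1) ^ (k + k) := Nat.one_le_pow _ _ (by omega)
  have hsq : (2 * r + 1) ^ 2 - 1 = 2 * (2 * r * (r + 1)) := by
    rw [Nat.sub_eq_iff_eq_add (Nat.one_le_pow _ _ (by omega))]; ring
  rw [one_pow, ← pow_mul, hsq, two_mul k] at hc
  have hdiv : (2 * r + 1) ^ (k + k) / 2 = 2 * r * ((r + 1) * c) := by
    have : 2 * (2 * r * (r + 1)) * c = 2 * (2 * r * ((r + 1) * c)) := by ring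
    omega
  rw [hdiv]
  exact ⟨(r + 1) * c, by simp⟩

/-- In an extension of even degree every nonzero element of the prime field is a square. -/
theorem quadraticChar_algebraMap_eq_one {q m : ℕ} [Fact q.Prime] (hq : Odd q) (hm : Even m)
    {F : Type*} [Field F] [Fintype F] [DecidableEq F] [Algebra (ZMod q) F]
    (hchar : ringChar F ≠ 2) (hF : Fintype.card F = q ^ m) {y : ZMod q} (hy : y ≠ 0) :
    quadraticChar F (algebraMap (ZMod q) F y) = 1 := by
  have hy' : algebraMap (ZMod q) F y ≠ 0 := by simpa using hy
  rw [quadraticChar_one_iff_isSquare hy', FiniteField.isSquare_iff hchar hy', hF]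
  obtain ⟨c, hc⟩ := card_sub_one_dvd_half_card_pow hq hm
  rw [hc, pow_mul, ← map_pow, ZMod.pow_card_sub_one_eq_one hy, map_one, one_pow]

theorem zetaQ_eq_stdAddChar (q : ℕ) [NeZero q] (s : ZMod q) :
    zetaQ q s = ZMod.stdAddChar s := by
  have h := ZMod.stdAddChar_coe (N := q) (s.val : ℤ)
  simp only [Int.cast_natCast, ZMod.natCast_zmod_val] at h
  rw [h, zetaQ]

/-- The canonical additive character `x ↦ exp(2πi·Tr(x)/q)` of an extension of `ZMod q`. -/
noncomputable def traceChar (q : ℕ) [NeZero q] (F : Type*) [Field F] [Algebra (ZMod q) F] :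
    AddChar F ℂ :=
  ZMod.stdAddChar.compAddMonoidHom (Algebra.trace (ZMod q) F).toAddMonoidHom

theorem traceChar_apply {q : ℕ} [NeZero q] {F : Type*} [Field F] [Algebra (ZMod q) F] (x : F) :
    traceChar q F x = ZMod.stdAddChar (Algebra.trace (ZMod q) F x) := rfl

section

variable {q : ℕ} [Fact q.Prime] {F : Type*} [Field F] [Fintype F] [Algebra (ZMod q) F]

theorem traceChar_ne_one : traceChar q F ≠ 1 := by
  intro h
  obtain ⟨x, hx⟩ := Algebra.trace_surjective (ZMod q) F 1
  have h1 : traceChar q F x = 1 := by rw [h, AddChar.one_apply]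
  rw [traceChar_apply, hx, ← AddChar.map_zero_eq_one (ZMod.stdAddChar (N := q))] at h1
  exact one_ne_zero (ZMod.injective_stdAddChar h1)

theorem gaussBig_eq_gaussSum [DecidableEq F] :
    gaussBig q F = gaussSum (quadraticCharTo F ℂ) (traceChar q F) := by
  rw [gaussBig, gaussSum, sum_filter]
  refine sum_congr rfl fun x _ => ?_
  by_cases hx : x = 0 <;> simp [hx, quadraticCharTo_apply, traceChar_apply, zetaQ_eq_stdAddChar]

theorem sum_stdAddChar_mul_trace_sq [DecidableEq F] {m : ℕ} (hq : Odd q) (hm : Even m)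
    (hchar : ringChar F ≠ 2) (hF : Fintype.card F = q ^ m) {y : ZMod q} (hy : y ≠ 0) :
    ∑ a : F, ZMod.stdAddChar (y * Algebra.trace (ZMod q) F (a ^ 2)) = gaussBig q F := by
  have hy' : algebraMap (ZMod q) F y ≠ 0 := by simpa using hy
  have hsum := sum_addChar_sq (R := ℂ) hchar
    (AddChar.IsPrimitive.of_ne_one (traceChar_ne_one (q := q) (F := F)) hy')
  have hshift := gaussSum_mulShift (quadraticCharTo F ℂ) (traceChar q F) (Units.mk0 _ hy')
  rw [Units.val_mk0, quadraticCharTo_apply,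
    quadraticChar_algebraMap_eq_one hq hm hchar hF hy, Int.cast_one, one_mul] at hshift
  rw [gaussBig_eq_gaussSum, ← hshift, ← hsum]
  refine sum_congr rfl fun a _ => ?_
  rw [AddChar.mulShift_apply, traceChar_apply, ← Algebra.smul_def, map_smul, smul_eq_mul]

/-- The number of `a` with `Tr(a²) = s`, in terms of the Gauss sum. -/
theorem card_trace_sq_eq [DecidableEq F] {m : ℕ} (hq : Odd q) (hm : Even m)
    (hchar : ringChar F ≠ 2) (hF : Fintype.card F = q ^ m) (s : ZMod q) :
    (q : ℂ) * #{a : F | Algebra.trace (ZMod q) F (a ^ 2) = s} =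
      q ^ m + ((if s = 0 then (q : ℂ) else 0) - 1) * gaussBig q F := by
  have horth : ∀ b : ZMod q, ∑ y : ZMod q, ZMod.stdAddChar (y * b) =
      if b = 0 then (q : ℂ) else 0 := fun b => by
    rw [AddChar.sum_mulShift b (ZMod.isPrimitive_stdAddChar q), ZMod.card]
    split_ifs <;> simp
  have hsplit : ∀ y : ZMod q,
      ∑ a : F, ZMod.stdAddChar (y * (Algebra.trace (ZMod q) F (a ^ 2) - s)) =
        (if y = 0 then (q : ℂ) ^ m - gaussBig q F else 0) +
          ZMod.stdAddChar (y * -s) * gaussBig q F := fun y => by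
    by_cases hy : y = 0
    · simp [hy, hF]
    · rw [if_neg hy, zero_add, ← sum_stdAddChar_mul_trace_sq hq hm hchar hF hy, mul_sum]
      refine sum_congr rfl fun a _ => ?_
      rw [← AddChar.map_add_eq_mul]
      congr 1
      ring
  calc (q : ℂ) * #{a : F | Algebra.trace (ZMod q) F (a ^ 2) = s}
      = ∑ a : F, ∑ y : ZMod q,
          ZMod.stdAddChar (y * (Algebra.trace (ZMod q) F (a ^ 2) - s)) := by
        simp_rw [horth, sub_eq_zero]
        rw [← sum_filter, sum_const, nsmul_eq_mul, mul_comm]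
    _ = _ := by
        rw [sum_comm]
        simp_rw [hsplit]
        rw [sum_add_distrib, ← sum_mul, horth]
        simp only [sum_ite_eq', mem_univ, if_true, neg_eq_zero]
        ring

end

theorem Ncount_eq_mul {q : ℕ} {F : Type*} [Field F] [Fintype F] [Algebra (ZMod q) F]
    (s t : ZMod q) : Ncount q F s t = #{a : F | Algebra.trace (ZMod q) F (a ^ 2) = s} *
      #{b : F | Algebra.trace (ZMod q) F (b ^ 2) = t} := by
  rw [Ncount, ← card_product, ← filter_product, univ_product_univ, Nat.card_eq_fintype_card,
    Fintype.card_subtype]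

theorem stmt1 (q m : ℕ) [Fact q.Prime] (hq : Odd q) (hm : 2 ≤ m) (hmeven : Even m)
    (F : Type*) [Field F] [Fintype F] [DecidableEq F] [Algebra (ZMod q) F]
    (hF : Fintype.card F = q ^ m) (s t : ZMod q) :
    (s = 0 ∧ t = 0 → (Ncount q F s t : ℂ) =
      ((q : ℂ) ^ ((m : ℤ) - 1) + (q : ℂ)⁻¹ * ((q : ℂ) - 1) * gaussBig q F) ^ 2) ∧
    (s ≠ 0 ∧ t = 0 → (Ncount q F s t : ℂ) = (q : ℂ) ^ (2 * (m : ℤ) - 2) +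
      (q : ℂ) ^ ((m : ℤ) - 2) * ((q : ℂ) - 2) * gaussBig q F -
      (q : ℂ) ^ (-2 : ℤ) * ((q : ℂ) - 1) * (gaussBig q F) ^ 2) ∧
    (s = 0 ∧ t ≠ 0 → (Ncount q F s t : ℂ) = (q : ℂ) ^ (2 * (m : ℤ) - 2) +
      (q : ℂ) ^ ((m : ℤ) - 2) * ((q : ℂ) - 2) * gaussBig q F -
      (q : ℂ) ^ (-2 : ℤ) * ((q : ℂ) - 1) * (gaussBig q F) ^ 2) ∧
    (s ≠ 0 ∧ t ≠ 0 → (Ncount q F s t : ℂ) =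
      ((q : ℂ) ^ ((m : ℤ) - 1) - (q : ℂ)⁻¹ * gaussBig q F) ^ 2) := by
  have hchar : ringChar F ≠ 2 := by
    intro h
    have : CharP F q := charP_of_injective_algebraMap (algebraMap (ZMod q) F).injective q
    rw [← ringChar.eq_iff.mpr this, h] at hq
    exact absurd hq (by decide)
  have hq0 : (q : ℂ) ≠ 0 := Nat.cast_ne_zero.mpr (Fact.out : q.Prime).ne_zero
  have hcount := card_trace_sq_eq hq hmeven hchar hF
  have hzero : (#{a : F | Algebra.trace (ZMod q) F (a ^ 2) = 0} : ℂ) =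
      (q : ℂ) ^ ((m : ℤ) - 1) + (q : ℂ)⁻¹ * ((q : ℂ) - 1) * gaussBig q F := by
    refine mul_left_cancel₀ hq0 ?_
    rw [hcount, if_pos rfl, zpow_sub_one₀ hq0, zpow_natCast]
    field_simp
  have hne : ∀ u : ZMod q, u ≠ 0 →
      (#{a : F | Algebra.trace (ZMod q) F (a ^ 2) = u} : ℂ) =
        (q : ℂ) ^ ((m : ℤ) - 1) - (q : ℂ)⁻¹ * gaussBig q F := fun u hu => by
    refine mul_left_cancel₀ hq0 ?_
    rw [hcount, if_neg hu, zpow_sub_one₀ hq0, zpow_natCast]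
    field_simp
    ring
  have hprod : ((q : ℂ) ^ ((m : ℤ) - 1) + (q : ℂ)⁻¹ * ((q : ℂ) - 1) * gaussBig q F) *
      ((q : ℂ) ^ ((m : ℤ) - 1) - (q : ℂ)⁻¹ * gaussBig q F) =
      (q : ℂ) ^ (2 * (m : ℤ) - 2) + (q : ℂ) ^ ((m : ℤ) - 2) * ((q : ℂ) - 2) * gaussBig q F -
        (q : ℂ) ^ (-2 : ℤ) * ((q : ℂ) - 1) * (gaussBig q F) ^ 2 := by
    have h1 : (q : ℂ) ^ ((m : ℤ) - 1) = q ^ ((m : ℤ) - 2) * q := by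
      rw [← zpow_add_one₀ hq0]; congr 1; ring
    have h2 : (q : ℂ) ^ (2 * (m : ℤ) - 2) = (q ^ ((m : ℤ) - 2) * q) ^ 2 := by
      rw [← h1, ← zpow_natCast, ← zpow_mul]; congr 1; push_cast; ring
    have h3 : (q : ℂ) ^ (-2 : ℤ) = (q : ℂ)⁻¹ ^ 2 := by
      rw [zpow_neg, inv_pow]; rfl
    rw [h1, h2, h3]
    field_simp
    ring
  rw [Ncount_eq_mul, Nat.cast_mul]
  refine ⟨?_, ?_, ?_, ?_⟩
  · rintro ⟨rfl, rfl⟩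
    rw [hzero, sq]
  · rintro ⟨hs, rfl⟩
    rw [hne s hs, hzero, mul_comm, hprod]
  · rintro ⟨rfl, ht⟩
    rw [hne t ht, hzero, hprod]
  · rintro ⟨hs, ht⟩
    rw [hne s hs, hne t ht, sq]
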